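/- arXiv:2402.08514 — 5 statements merged into one kernel-verified Lean document; each statement's English description precedes it below -/
import Mathlib

section
/- Let S be a finite nonempty set, let w : S → ℝ be strictly positive weights, and let (G_s)_{s∈S} be independent standard Gumbel random variables. Then for every s* ∈ S, the probability of the event {for all s ∈ S with s ≠ s*, log w(s*) + G_{s*} > log w(s) + G_s} equals w(s*) / (∑_{s∈S} w(s)). In particular, when w is a probability mass function p, the argmax of log p(s) + G_s over s is distributed according to p (the Gumbel-max trick). -/
open MeasureTheory ProbabilityTheory

open Filter Topology in
lemma gumbel_aux_Ioi (k : ℝ) (hk : 0 < k) (a : ℝ) :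
    ∫⁻ x in Set.Ioi a, ENNReal.ofReal (Real.exp (-x) * Real.exp (-(k * Real.exp (-x))))
      = ENNReal.ofReal ((1 - Real.exp (-(k * Real.exp (-a)))) / k) := by
  have hd : ∀ x : ℝ, HasDerivAt (fun x => Real.exp (-(k * Real.exp (-x))) / k)
      (Real.exp (-x) * Real.exp (-(k * Real.exp (-x)))) x := by
    intro x
    have h := ((((hasDerivAt_neg x).exp).const_mul k).neg.exp).div_const k
    refine h.congr_deriv ?_
    simp only [Pi.neg_apply]
    field_simp
  have hlim : Tendsto (fun x => Real.exp (-(k * Real.exp (-x))) / k) atTop (𝓝 (1 / k)) := by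
    have h1 : Tendsto (fun x : ℝ => Real.exp (-x)) atTop (𝓝 0) :=
      Real.tendsto_exp_neg_atTop_nhds_zero
    have h2 := ((Real.continuous_exp.tendsto _).comp ((h1.const_mul k).neg)).div_const k
    simpa using h2
  have hpos : ∀ x : ℝ, 0 ≤ Real.exp (-x) * Real.exp (-(k * Real.exp (-x))) :=
    fun x => by positivity
  have hi := integrableOn_Ioi_deriv_of_nonneg' (a := a) (fun x _ => hd x) (fun x _ => hpos x) hlim
  have he := integral_Ioi_of_hasDerivAt_of_nonneg' (a := a) (fun x _ => hd x)
    (fun x _ => hpos x) hlim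
  rw [← ofReal_integral_eq_lintegral_ofReal hi (ae_of_all _ hpos), he]
  congr 1
  ring

open Filter Topology in
lemma gumbel_aux_univ (k : ℝ) (hk : 0 < k) :
    ∫⁻ x, ENNReal.ofReal (Real.exp (-x) * Real.exp (-(k * Real.exp (-x))))
      = ENNReal.ofReal (1 / k) := by
  refine (aecover_Ioi (μ := volume) (l := atBot) tendsto_id).lintegral_eq_of_tendsto _
    (by fun_prop) ?_
  simp only [id, gumbel_aux_Ioi k hk]
  refine ENNReal.tendsto_ofReal ?_
  have h1 : Tendsto (fun a : ℝ => k * Real.exp (-a)) atBot atTop :=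
    (Real.tendsto_exp_atTop.comp tendsto_neg_atBot_atTop).const_mul_atTop hk
  have h2 := ((Real.tendsto_exp_neg_atTop_nhds_zero.comp h1).const_sub 1).div_const k
  simpa using h2

lemma gumbel_aux_law (ν : Measure ℝ) [IsProbabilityMeasure ν]
    (h : ∀ x, ν (Set.Iic x) = ENNReal.ofReal (Real.exp (-Real.exp (-x)))) :
    ν = volume.withDensity
      (fun x => ENNReal.ofReal (Real.exp (-x) * Real.exp (-(1 * Real.exp (-x))))) := by
  have hu := gumbel_aux_univ 1 one_pos
  refine Measure.ext_of_Iic _ _ fun a => ?_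
  have : IsProbabilityMeasure (volume.withDensity
      (fun x => ENNReal.ofReal (Real.exp (-x) * Real.exp (-(1 * Real.exp (-x)))))) :=
    ⟨by rw [withDensity_apply _ .univ, setLIntegral_univ, hu]; simp⟩
  rw [h, ← compl_compl (Set.Iic a), prob_compl_eq_one_sub measurableSet_Iic.compl, Set.compl_Iic,
    withDensity_apply _ measurableSet_Ioi, gumbel_aux_Ioi 1 one_pos, ← ENNReal.ofReal_one,
    ← ENNReal.ofReal_sub _ (by simp [Real.exp_nonneg])]
  simp

/-- Gumbel-max trick: For independent standard Gumbel random variables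
`(G s)_{s ∈ S}` over a finite nonempty set `S` and strictly positive weights `w : S → ℝ`,
the probability that `log (w s*) + G s*` strictly exceeds `log (w s) + G s` for all `s ≠ s*`
equals `w s* / ∑ s, w s`. -/
theorem gumbel_max_trick
    {Ω : Type*} [MeasurableSpace Ω] (μ : Measure Ω) [IsProbabilityMeasure μ]
    {S : Type*} [Fintype S] [Nonempty S]
    (w : S → ℝ) (hw : ∀ s, 0 < w s)
    (G : S → Ω → ℝ)
    (hGmeas : ∀ s, Measurable (G s))
    (hGindep : iIndepFun (m := fun _ => Real.measurableSpace) G μ)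
    (hGumbel : ∀ s x, μ {ω | G s ω ≤ x} = ENNReal.ofReal (Real.exp (-Real.exp (-x))))
    (sStar : S) :
    μ {ω | ∀ s : S, s ≠ sStar → Real.log (w s) + G s ω < Real.log (w sStar) + G sStar ω}
      = ENNReal.ofReal (w sStar / ∑ s : S, w s) := by
  classical
  have hlaw : ∀ s, μ.map (G s) = volume.withDensity
      (fun x => ENNReal.ofReal (Real.exp (-x) * Real.exp (-(1 * Real.exp (-x))))) := by
    intro s
    have := Measure.isProbabilityMeasure_map (μ := μ) (hGmeas s).aemeasurable
    refine gumbel_aux_law _ fun x => ?_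
    rw [Measure.map_apply (hGmeas s) measurableSet_Iic, ← hGumbel s x]
    rfl
  have hlt : ∀ s x, μ (G s ⁻¹' Set.Iio x) = ENNReal.ofReal (Real.exp (-Real.exp (-x))) := by
    intro s x
    rw [← hGumbel s x, ← Measure.map_apply (hGmeas s) measurableSet_Iio,
      show {ω | G s ω ≤ x} = G s ⁻¹' Set.Iic x from rfl,
      ← Measure.map_apply (hGmeas s) measurableSet_Iic, hlaw s]
    exact measure_congr Iio_ae_eq_Iic
  set T : Finset S := Finset.univ.erase sStar with hT
  have hY : Measurable (fun ω (i : T) => G i ω) := by fun_prop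
  have hind : IndepFun (G sStar) (fun ω (i : T) => G i ω) μ := by
    have h := hGindep.indepFun_finset {sStar} T (by simp [hT]) hGmeas
    exact h.comp (φ := fun f : (({sStar} : Finset S) → ℝ) => f ⟨sStar, by simp⟩) (ψ := id)
      (measurable_pi_apply _) measurable_id
  have hmap := hind.map_prod_eq_prod_map_map (hGmeas sStar).aemeasurable hY.aemeasurable
  set B : Set (ℝ × (T → ℝ)) :=
    {p | ∀ s : T, Real.log (w s) + p.2 s < Real.log (w sStar) + p.1} with hB
  have hBm : MeasurableSet B := by
    rw [hB, Set.ofPred_forall]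
    exact MeasurableSet.iInter fun s => measurableSet_lt (by fun_prop) (by fun_prop)
  have hev : {ω | ∀ s : S, s ≠ sStar → Real.log (w s) + G s ω < Real.log (w sStar) + G sStar ω}
      = (fun ω => (G sStar ω, fun i : T => G i ω)) ⁻¹' B := by
    ext ω
    simp [hB, hT]
  have hYp := Measure.isProbabilityMeasure_map (μ := μ) hY.aemeasurable
  set c : ℝ := ∑ s ∈ T, w s / w sStar with hc
  have hc0 : 0 ≤ c := Finset.sum_nonneg fun s _ => (div_pos (hw s) (hw sStar)).le
  have hin : ∀ x : ℝ, (μ.map (fun ω (i : T) => G i ω)) (Prod.mk x ⁻¹' B)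
      = ENNReal.ofReal (Real.exp (-(c * Real.exp (-x)))) := by
    intro x
    rw [Measure.map_apply hY (measurable_prodMk_left hBm)]
    have hset : (fun ω (i : T) => G i ω) ⁻¹' (Prod.mk x ⁻¹' B)
        = ⋂ s ∈ T, G s ⁻¹' Set.Iio (Real.log (w sStar) + x - Real.log (w s)) := by
      ext ω
      simp [hB, lt_sub_iff_add_lt']
    rw [hset, hGindep.measure_inter_preimage_eq_mul T (fun s _ => measurableSet_Iio)]
    simp only [hlt]
    rw [← ENNReal.ofReal_prod_of_nonneg (fun s _ => (Real.exp_pos _).le), ← Real.exp_sum]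
    congr 2
    rw [Finset.sum_neg_distrib, hc, Finset.sum_mul]
    congr 1
    refine Finset.sum_congr rfl fun s _ => ?_
    rw [show -(Real.log (w sStar) + x - Real.log (w s))
      = Real.log (w s) - Real.log (w sStar) + -x by ring, Real.exp_add, Real.exp_sub,
      Real.exp_log (hw s), Real.exp_log (hw sStar)]
  rw [hev, ← Measure.map_apply ((hGmeas sStar).prodMk hY) hBm, hmap, Measure.prod_apply hBm]
  simp only [hin]
  rw [hlaw, lintegral_withDensity_eq_lintegral_mul _ (by fun_prop) (by fun_prop)]
  have hk := gumbel_aux_univ (1 + c) (by linarith)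
  convert hk using 1
  · refine lintegral_congr fun x => ?_
    rw [Pi.mul_apply, ← ENNReal.ofReal_mul (by positivity), mul_assoc, ← Real.exp_add]
    congr 3
    ring_nf
  · congr 1
    have hs : ∑ s, w s = w sStar + ∑ s ∈ T, w s := by
      rw [hT, Finset.add_sum_erase _ _ (Finset.mem_univ _)]
    have h0 := hw sStar
    have h1 : 0 ≤ ∑ s ∈ T, w s := Finset.sum_nonneg fun s _ => (hw s).le
    rw [hs, hc, ← Finset.sum_div]
    field_simp
end

section
/- Let S be a finite nonempty set, let w : S → ℝ be strictly positive weights, and let (G_s)_{s∈S} be independent standard Gumbel random variables. Define M = max_{s∈S} (log w(s) + G_s). Then for every x ∈ ℝ, P(M ≤ x) = exp(−exp(−(x − log ∑_{s∈S} w(s)))); that is, M is distributed as a Gumbel random variable with location parameter log ∑_{s∈S} w(s). -/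
open MeasureTheory ProbabilityTheory

/-- For independent standard Gumbel random variables `(G s)_{s ∈ S}` over a
finite nonempty set `S` and strictly positive weights `w : S → ℝ`, the maximum
`M = max_{s} (log (w s) + G s)` is distributed as a Gumbel random variable with location
parameter `log (∑ s, w s)`, i.e. `P(M ≤ x) = exp (-exp (-(x - log ∑ s, w s)))`. -/
theorem gumbel_max_distribution
    {Ω : Type*} [MeasurableSpace Ω] (μ : Measure Ω) [IsProbabilityMeasure μ]
    {S : Type*} [Fintype S] [Nonempty S]
    (w : S → ℝ) (hw : ∀ s, 0 < w s)
    (G : S → Ω → ℝ)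
    (hGmeas : ∀ s, Measurable (G s))
    (hGindep : iIndepFun (m := fun _ => Real.measurableSpace) G μ)
    (hGumbel : ∀ s x, μ {ω | G s ω ≤ x} = ENNReal.ofReal (Real.exp (-Real.exp (-x))))
    (x : ℝ) :
    μ {ω | Finset.univ.sup' Finset.univ_nonempty (fun s : S => Real.log (w s) + G s ω) ≤ x}
      = ENNReal.ofReal (Real.exp (-Real.exp (-(x - Real.log (∑ s : S, w s))))) := by
  have hset : {ω | Finset.univ.sup' Finset.univ_nonempty
      (fun s : S => Real.log (w s) + G s ω) ≤ x}
      = ⋂ s ∈ (Finset.univ : Finset S), G s ⁻¹' Set.Iic (x - Real.log (w s)) := by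
    ext ω
    simp only [Set.mem_setOf_eq, Finset.sup'_le_iff, Set.mem_iInter, Set.mem_preimage,
      Set.mem_Iic, le_sub_iff_add_le']
  have hsum : 0 < ∑ s : S, w s := Finset.sum_pos (fun s _ => hw s) Finset.univ_nonempty
  have key : ∀ a : ℝ, 0 < a → Real.exp (-(x - Real.log a)) = a * Real.exp (-x) := by
    intro a ha
    rw [show -(x - Real.log a) = Real.log a + -x by ring, Real.exp_add, Real.exp_log ha]
  have hfac : ∀ s, μ (G s ⁻¹' Set.Iic (x - Real.log (w s)))
      = ENNReal.ofReal (Real.exp (-(w s * Real.exp (-x)))) := by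
    intro s
    rw [← key _ (hw s)]
    exact hGumbel s _
  rw [hset, hGindep.measure_inter_preimage_eq_mul Finset.univ (fun s _ => measurableSet_Iic),
    Finset.prod_congr rfl (fun s _ => hfac s),
    ← ENNReal.ofReal_prod_of_nonneg (fun s _ => (Real.exp_pos _).le), ← Real.exp_sum,
    key _ hsum, Finset.sum_neg_distrib, Finset.sum_mul]
end

section
/- Let S be a finite nonempty set, let w : S → ℝ be strictly positive weights, and let (G_s)_{s∈S} be independent standard Gumbel random variables. Define M = max_{s∈S} (log w(s) + G_s). Then for every s* ∈ S and every x ∈ ℝ, P({for all s ≠ s*, log w(s*) + G_{s*} > log w(s) + G_s} ∩ {M ≤ x}) = P(for all s ≠ s*, log w(s*) + G_{s*} > log w(s) + G_s) · P(M ≤ x); that is, the (almost surely unique) argmax of log w(s) + G_s is independent of the maximum value M. -/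
open MeasureTheory ProbabilityTheory

lemma unif_law {Ω : Type*} [MeasurableSpace Ω] (μ : Measure Ω) [IsProbabilityMeasure μ]
    (X : Ω → ℝ) (hX : Measurable X)
    (h : ∀ x, μ {ω | X ω ≤ x} = ENNReal.ofReal (Real.exp (-Real.exp (-x)))) :
    μ.map (fun ω => Real.exp (-Real.exp (-(X ω)))) = volume.restrict (Set.Ioc (0:ℝ) 1) := by
  have hm : Measurable (fun ω => Real.exp (-Real.exp (-(X ω)))) := by fun_prop
  have : IsProbabilityMeasure (μ.map (fun ω => Real.exp (-Real.exp (-(X ω))))) :=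
    Measure.isProbabilityMeasure_map hm.aemeasurable
  refine Measure.ext_of_Iic _ _ fun t => ?_
  rw [Measure.map_apply hm measurableSet_Iic, Measure.restrict_apply measurableSet_Iic]
  have h01 : ∀ ω, 0 < Real.exp (-Real.exp (-(X ω))) ∧ Real.exp (-Real.exp (-(X ω))) < 1 := by
    intro ω
    refine ⟨Real.exp_pos _, ?_⟩
    rw [Real.exp_lt_one_iff]
    linarith [Real.exp_pos (-(X ω))]
  rcases le_or_gt t 0 with ht | ht
  · have e1 : (fun ω => Real.exp (-Real.exp (-(X ω)))) ⁻¹' Set.Iic t = ∅ := by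
      ext ω; simp only [Set.mem_preimage, Set.mem_Iic, Set.mem_empty_iff_false, iff_false]
      linarith [(h01 ω).1]
    have e2 : Set.Iic t ∩ Set.Ioc (0:ℝ) 1 = ∅ := by
      ext y; simp only [Set.mem_inter_iff, Set.mem_Iic, Set.mem_Ioc, Set.mem_empty_iff_false,
        iff_false]
      rintro ⟨a, b, c⟩; linarith
    rw [e1, e2]; simp
  rcases lt_or_ge t 1 with h1 | h1
  · have e2 : Set.Iic t ∩ Set.Ioc (0:ℝ) 1 = Set.Ioc 0 t := by
      ext y; simp only [Set.mem_inter_iff, Set.mem_Iic, Set.mem_Ioc]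
      constructor
      · rintro ⟨a, b, c⟩; exact ⟨b, a⟩
      · rintro ⟨a, b⟩; exact ⟨b, a, by linarith⟩
    have hl : 0 < -Real.log t := by linarith [Real.log_neg ht h1]
    have e3 : Real.exp (-Real.exp (-(-Real.log (-Real.log t)))) = t := by
      rw [neg_neg, Real.exp_log hl, neg_neg, Real.exp_log ht]
    have e1 : (fun ω => Real.exp (-Real.exp (-(X ω)))) ⁻¹' Set.Iic t
        = {ω | X ω ≤ -Real.log (-Real.log t)} := by
      ext ω; simp only [Set.mem_preimage, Set.mem_Iic, Set.mem_ofPred_eq]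
      conv_lhs => rw [← e3]
      rw [Real.exp_le_exp, neg_le_neg_iff, Real.exp_le_exp, neg_le_neg_iff]
    rw [e1, e2, h, e3, Real.volume_Ioc, sub_zero]
  · have e1 : (fun ω => Real.exp (-Real.exp (-(X ω)))) ⁻¹' Set.Iic t = Set.univ := by
      ext ω; simp only [Set.mem_preimage, Set.mem_Iic, Set.mem_univ, iff_true]
      linarith [(h01 ω).2]
    have e2 : Set.Iic t ∩ Set.Ioc (0:ℝ) 1 = Set.Ioc 0 1 := by
      ext y; simp only [Set.mem_inter_iff, Set.mem_Iic, Set.mem_Ioc]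
      constructor
      · rintro ⟨a, b, c⟩; exact ⟨b, c⟩
      · rintro ⟨a, b⟩; exact ⟨by linarith, a, b⟩
    rw [e1, e2]; simp

lemma unif_argmax {Ω : Type*} [MeasurableSpace Ω] (μ : Measure Ω) [IsProbabilityMeasure μ]
    {S : Type*} [Fintype S] [DecidableEq S] (U : S → Ω → ℝ) (hU : ∀ s, Measurable (U s))
    (hind : iIndepFun (m := fun _ => Real.measurableSpace) U μ)
    (hlaw : ∀ s, μ.map (U s) = volume.restrict (Set.Ioc (0:ℝ) 1))
    (p : S → ℝ) (hp : ∀ s, 0 ≤ p s) (s0 : S) (u : ℝ) (hu0 : 0 ≤ u) (hu1 : u ≤ 1) :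
    μ {ω | (∀ s, s ≠ s0 → U s ω < U s0 ω ^ p s) ∧ U s0 ω ≤ u}
      = ENNReal.ofReal (u ^ ((∑ s ∈ Finset.univ.erase s0, p s) + 1)
          / ((∑ s ∈ Finset.univ.erase s0, p s) + 1)) := by
  set T := Finset.univ.erase s0 with hT
  set r := ∑ s ∈ T, p s with hr
  have hr0 : 0 ≤ r := Finset.sum_nonneg fun s _ => hp s
  let Z : Ω → (T → ℝ) := fun ω i => U i ω
  have hZ : Measurable Z := measurable_pi_lambda _ fun i => hU i
  have hi : IndepFun (U s0) Z μ := by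
    have h1 := hind.indepFun_finset {s0} T (by simp [hT]) hU
    exact h1.comp (φ := fun f : (({s0} : Finset S) → ℝ) => f ⟨s0, by simp⟩) (ψ := id)
      (measurable_pi_apply _) measurable_id
  have hprod := (indepFun_iff_map_prod_eq_prod_map_map (hU s0).aemeasurable hZ.aemeasurable).1 hi
  let B : Set (ℝ × (T → ℝ)) := {q | (∀ i : T, q.2 i < q.1 ^ p i) ∧ q.1 ≤ u}
  have hB : MeasurableSet B := by
    have hBe : B = (⋂ i : T, {q : ℝ × (T → ℝ) | q.2 i < q.1 ^ p i})
        ∩ {q : ℝ × (T → ℝ) | q.1 ≤ u} := by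
      ext q; simp [B]
    rw [hBe]
    refine MeasurableSet.inter ?_ ?_
    · refine MeasurableSet.iInter fun i => measurableSet_lt ?_ ?_
      · fun_prop
      · fun_prop
    · exact measurableSet_le measurable_fst measurable_const
  have hset : {ω | (∀ s, s ≠ s0 → U s ω < U s0 ω ^ p s) ∧ U s0 ω ≤ u}
      = (fun ω => (U s0 ω, Z ω)) ⁻¹' B := by
    ext ω
    simp [B, Z, hT]
  have : IsProbabilityMeasure (μ.map Z) := Measure.isProbabilityMeasure_map hZ.aemeasurable
  rw [hset, ← Measure.map_apply ((hU s0).prodMk hZ) hB, hprod, Measure.prod_apply hB, hlaw]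
  have key : ∀ v ∈ Set.Ioc (0:ℝ) 1, (μ.map Z) (Prod.mk v ⁻¹' B)
      = (Set.Iic u).indicator (fun v => ENNReal.ofReal (v ^ r)) v := by
    intro v hv
    rw [Measure.map_apply hZ (measurable_prodMk_left hB)]
    by_cases hvu : v ≤ u
    · rw [Set.indicator_of_mem (by exact hvu)]
      have e : Z ⁻¹' (Prod.mk v ⁻¹' B) = ⋂ s ∈ T, U s ⁻¹' Set.Iio (v ^ p s) := by
        ext ω; simp [B, Z, hvu]
      rw [e, hind.measure_inter_preimage_eq_mul T (fun s _ => measurableSet_Iio)]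
      have e2 : ∀ s ∈ T, μ (U s ⁻¹' Set.Iio (v ^ p s)) = ENNReal.ofReal (v ^ p s) := by
        intro s _
        rw [← Measure.map_apply (hU s) measurableSet_Iio, hlaw,
          Measure.restrict_apply measurableSet_Iio]
        have : Set.Iio (v ^ p s) ∩ Set.Ioc (0:ℝ) 1 = Set.Ioo 0 (v ^ p s) := by
          have := Real.rpow_le_one hv.1.le hv.2 (hp s)
          ext y; simp only [Set.mem_inter_iff, Set.mem_Iio, Set.mem_Ioc, Set.mem_Ioo]
          constructor
          · rintro ⟨a, b, c⟩; exact ⟨b, a⟩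
          · rintro ⟨a, b⟩; exact ⟨b, a, by linarith⟩
        rw [this, Real.volume_Ioo, sub_zero]
      rw [Finset.prod_congr rfl e2, ← ENNReal.ofReal_prod_of_nonneg
        (fun s _ => Real.rpow_nonneg hv.1.le _), hr, Real.rpow_sum_of_pos hv.1]
    · rw [Set.indicator_of_notMem (by exact hvu)]
      have e : Z ⁻¹' (Prod.mk v ⁻¹' B) = ∅ := by
        ext ω; simp [B, hvu]
      rw [e]; simp
  rw [setLIntegral_congr_fun measurableSet_Ioc key, setLIntegral_indicator measurableSet_Iic]
  have e2 : Set.Iic u ∩ Set.Ioc (0:ℝ) 1 = Set.Ioc 0 u := by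
    ext y; simp only [Set.mem_inter_iff, Set.mem_Iic, Set.mem_Ioc]
    constructor
    · rintro ⟨a, b, c⟩; exact ⟨b, a⟩
    · rintro ⟨a, b⟩; exact ⟨b, a, by linarith⟩
  have hint : IntervalIntegrable (fun v : ℝ => v ^ r) volume 0 u :=
    intervalIntegral.intervalIntegrable_rpow (Or.inl hr0)
  rw [e2, ← ofReal_integral_eq_lintegral_ofReal]
  · rw [← intervalIntegral.integral_of_le hu0, integral_rpow (Or.inl (by linarith)),
      Real.zero_rpow (by linarith), sub_zero]
  · exact (intervalIntegrable_iff_integrableOn_Ioc_of_le hu0).1 hint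
  · exact (ae_restrict_iff' measurableSet_Ioc).2
      (Filter.Eventually.of_forall fun v hv => Real.rpow_nonneg hv.1.le _)



/-- For independent standard Gumbel random variables `(G s)_{s ∈ S}` over a
finite nonempty set `S` and strictly positive weights `w : S → ℝ`, the event that `s*` is
the argmax of `log (w s) + G s` is independent of the event `{M ≤ x}`, where
`M = max_s (log (w s) + G s)`. -/
theorem gumbel_argmax_indep_max
    {Ω : Type*} [MeasurableSpace Ω] (μ : Measure Ω) [IsProbabilityMeasure μ]
    {S : Type*} [Fintype S] [Nonempty S]
    (w : S → ℝ) (hw : ∀ s, 0 < w s)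
    (G : S → Ω → ℝ)
    (hGmeas : ∀ s, Measurable (G s))
    (hGindep : iIndepFun (m := fun _ => Real.measurableSpace) G μ)
    (hGumbel : ∀ s x, μ {ω | G s ω ≤ x} = ENNReal.ofReal (Real.exp (-Real.exp (-x))))
    (sStar : S) (x : ℝ) :
    μ ({ω | ∀ s : S, s ≠ sStar → Real.log (w s) + G s ω < Real.log (w sStar) + G sStar ω}
        ∩ {ω | Finset.univ.sup' Finset.univ_nonempty
            (fun s : S => Real.log (w s) + G s ω) ≤ x})
      = μ {ω | ∀ s : S, s ≠ sStar →
            Real.log (w s) + G s ω < Real.log (w sStar) + G sStar ω}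
        * μ {ω | Finset.univ.sup' Finset.univ_nonempty
            (fun s : S => Real.log (w s) + G s ω) ≤ x} := by
  classical
  let U : S → Ω → ℝ := fun s ω => Real.exp (-Real.exp (-(G s ω)))
  have hU : ∀ s, Measurable (U s) := fun s => by
    have := hGmeas s
    simp only [U]; fun_prop
  have hind : iIndepFun (m := fun _ => Real.measurableSpace) U μ :=
    hGindep.comp (fun _ y => Real.exp (-Real.exp (-y))) (fun _ => by fun_prop)
  have hlaw : ∀ s, μ.map (U s) = volume.restrict (Set.Ioc (0:ℝ) 1) :=
    fun s => unif_law μ (G s) (hGmeas s) (hGumbel s)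
  have key := unif_argmax μ U hU hind hlaw (fun s => w s / w sStar)
    (fun s => (div_pos (hw s) (hw sStar)).le) sStar
  set r := ∑ s ∈ Finset.univ.erase sStar, w s / w sStar with hr
  have hr0 : 0 ≤ r := Finset.sum_nonneg fun s _ => (div_pos (hw s) (hw sStar)).le
  have hrW : w sStar * (r + 1) = ∑ s, w s := by
    rw [← Finset.add_sum_erase Finset.univ w (Finset.mem_univ sStar), hr, ← Finset.sum_div]
    have := (hw sStar).ne'
    field_simp
    ring
  have hcond : ∀ s ω, U s ω < U sStar ω ^ (w s / w sStar) ↔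
      Real.log (w s) + G s ω < Real.log (w sStar) + G sStar ω := by
    intro s ω
    simp only [U]
    rw [← Real.exp_mul, Real.exp_lt_exp, neg_mul, neg_lt_neg_iff, ← mul_div_assoc,
      div_lt_iff₀ (hw sStar)]
    have e1 : Real.exp (-(G sStar ω)) * w s = Real.exp (-(G sStar ω) + Real.log (w s)) := by
      rw [Real.exp_add, Real.exp_log (hw s)]
    have e2 : Real.exp (-(G s ω)) * w sStar = Real.exp (-(G s ω) + Real.log (w sStar)) := by
      rw [Real.exp_add, Real.exp_log (hw sStar)]
    rw [e1, e2, Real.exp_lt_exp]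
    constructor <;> intro h <;> linarith
  have hexp : ∀ s, Real.exp (-(x - Real.log (w s))) = w s * Real.exp (-x) := by
    intro s
    rw [neg_sub, sub_eq_add_neg, Real.exp_add, Real.exp_log (hw s)]
  set u := Real.exp (-(w sStar * Real.exp (-x))) with hu
  have hu1 : u ≤ 1 := by
    rw [hu, Real.exp_le_one_iff]
    linarith [mul_pos (hw sStar) (Real.exp_pos (-x))]
  have hcu : ∀ ω, U sStar ω ≤ u ↔ Real.log (w sStar) + G sStar ω ≤ x := by
    intro ω
    simp only [U]
    rw [hu, ← hexp, Real.exp_le_exp, neg_le_neg_iff, Real.exp_le_exp, neg_le_neg_iff]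
    constructor <;> intro h <;> linarith
  have hA : {ω | ∀ s : S, s ≠ sStar → Real.log (w s) + G s ω < Real.log (w sStar) + G sStar ω}
      = {ω | (∀ s, s ≠ sStar → U s ω < U sStar ω ^ (w s / w sStar)) ∧ U sStar ω ≤ 1} := by
    ext ω
    have : U sStar ω ≤ 1 := by
      simp only [U]
      rw [Real.exp_le_one_iff]
      linarith [Real.exp_pos (-(G sStar ω))]
    simp only [Set.mem_ofPred_eq, hcond, this, and_true]
  have hAM : {ω | ∀ s : S, s ≠ sStar →
        Real.log (w s) + G s ω < Real.log (w sStar) + G sStar ω}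
        ∩ {ω | Finset.univ.sup' Finset.univ_nonempty
            (fun s : S => Real.log (w s) + G s ω) ≤ x}
      = {ω | (∀ s, s ≠ sStar → U s ω < U sStar ω ^ (w s / w sStar)) ∧ U sStar ω ≤ u} := by
    ext ω
    simp only [Set.mem_inter_iff, Set.mem_ofPred_eq, hcond, hcu, Finset.sup'_le_iff,
      Finset.mem_univ, true_implies]
    refine and_congr_right fun h => ⟨fun h2 => h2 sStar, fun h2 s => ?_⟩
    by_cases hs : s = sStar
    · rw [hs]; exact h2
    · exact (h s hs).le.trans h2
  have hM : μ {ω | Finset.univ.sup' Finset.univ_nonempty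
            (fun s : S => Real.log (w s) + G s ω) ≤ x} = ENNReal.ofReal (u ^ (r + 1)) := by
    have e : {ω | Finset.univ.sup' Finset.univ_nonempty
            (fun s : S => Real.log (w s) + G s ω) ≤ x}
        = ⋂ s ∈ (Finset.univ : Finset S), G s ⁻¹' Set.Iic (x - Real.log (w s)) := by
      ext ω
      simp [Finset.sup'_le_iff, le_sub_iff_add_le']
    have e2 : ∀ s ∈ (Finset.univ : Finset S), μ (G s ⁻¹' Set.Iic (x - Real.log (w s)))
        = ENNReal.ofReal (Real.exp (-(w s * Real.exp (-x)))) := by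
      intro s _
      rw [← hexp]
      exact hGumbel s _
    rw [e, hGindep.measure_inter_preimage_eq_mul Finset.univ (fun s _ => measurableSet_Iic),
      Finset.prod_congr rfl e2, ← ENNReal.ofReal_prod_of_nonneg (fun s _ => (Real.exp_pos _).le),
      ← Real.exp_sum, hu, ← Real.exp_mul, Finset.sum_neg_distrib, ← Finset.sum_mul, ← hrW]
    congr 2
    ring
  rw [hAM, hA, hM, key u (Real.exp_pos _).le hu1, key 1 zero_le_one le_rfl,
    Real.one_rpow, ← ENNReal.ofReal_mul (by positivity)]
  congr 1
  ring
end

section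
/- Let S be a finite nonempty set, let p and q be probability mass functions on S whose supports are disjoint, and let (G_s)_{s∈S} be independent standard Gumbel random variables. Fix s₁ in the support of p and let E be the event {for all s in the support of p with s ≠ s₁, log p(s₁) + G_{s₁} > log p(s) + G_s}. Then for every s' in the support of q, P({for all s in the support of q with s ≠ s', log q(s') + G_{s'} > log q(s) + G_s} | E) = q(s'); that is, the counterfactual distribution obtained by conditioning the Gumbel-max mechanism for q on the observation event E for p is identical to the interventional distribution q. -/
open MeasureTheory ProbabilityTheory

lemma gumbel_hasDerivAt (k : ℝ) (hk : 0 < k) (x : ℝ) :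
    HasDerivAt (fun x => k⁻¹ * Real.exp (-(k * Real.exp (-x))))
      (Real.exp (-x) * Real.exp (-(k * Real.exp (-x)))) x := by
  have h := ((((hasDerivAt_neg x).exp.const_mul k).neg).exp).const_mul k⁻¹
  refine h.congr_deriv ?_
  have hk' : k⁻¹ * k = 1 := inv_mul_cancel₀ hk.ne'
  simp only [Pi.neg_apply]
  linear_combination (Real.exp (-x) * Real.exp (-(k * Real.exp (-x)))) * hk'

lemma gumbel_cont (k : ℝ) :
    Continuous (fun x : ℝ => Real.exp (-x) * Real.exp (-(k * Real.exp (-x)))) := by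
  fun_prop

lemma gumbel_integrable (k : ℝ) (hk : 0 < k) :
    Integrable (fun x : ℝ => Real.exp (-x) * Real.exp (-(k * Real.exp (-x)))) := by
  refine integrable_of_intervalIntegral_norm_bounded (l := Filter.atTop)
    (a := fun n : ℕ => -(n : ℝ)) (b := fun n : ℕ => (n : ℝ)) k⁻¹ ?_ ?_ ?_ ?_
  · intro i
    exact (gumbel_cont k).integrableOn_Ioc
  · exact Filter.tendsto_neg_atTop_atBot.comp tendsto_natCast_atTop_atTop
  · exact tendsto_natCast_atTop_atTop
  · refine Filter.Eventually.of_forall fun n => ?_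
    have h0 : ∀ x : ℝ, ‖Real.exp (-x) * Real.exp (-(k * Real.exp (-x)))‖
        = Real.exp (-x) * Real.exp (-(k * Real.exp (-x))) := fun x => by
      rw [Real.norm_of_nonneg]; positivity
    simp_rw [h0]
    rw [intervalIntegral.integral_eq_sub_of_hasDerivAt
      (fun x _ => gumbel_hasDerivAt k hk x) ((gumbel_cont k).intervalIntegrable _ _)]
    have h1 : Real.exp (-(k * Real.exp (-(n : ℝ)))) ≤ 1 := by
      rw [Real.exp_le_one_iff]
      have := mul_pos hk (Real.exp_pos (-(n : ℝ)))
      linarith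
    have h2 : 0 ≤ k⁻¹ * Real.exp (-(k * Real.exp (-(-(n : ℝ))))) := by positivity
    have h3 := mul_le_mul_of_nonneg_left h1 (inv_pos.2 hk).le
    simp only [mul_one] at h3
    linarith

lemma gumbel_tendsto_atBot (k : ℝ) (hk : 0 < k) :
    Filter.Tendsto (fun x => k⁻¹ * Real.exp (-(k * Real.exp (-x)))) Filter.atBot (nhds 0) := by
  have h : Filter.Tendsto (fun x : ℝ => Real.exp (-(k * Real.exp (-x)))) Filter.atBot (nhds 0) :=
    Real.tendsto_exp_neg_atTop_nhds_zero.comp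
      ((Real.tendsto_exp_atTop.comp Filter.tendsto_neg_atBot_atTop).const_mul_atTop hk)
  simpa using h.const_mul k⁻¹

lemma gumbel_tendsto_atTop (k : ℝ) :
    Filter.Tendsto (fun x => k⁻¹ * Real.exp (-(k * Real.exp (-x)))) Filter.atTop
      (nhds k⁻¹) := by
  have h := ((((Real.continuous_exp.tendsto 0).comp
    (by simpa using ((Real.tendsto_exp_neg_atTop_nhds_zero).const_mul k).neg :
      Filter.Tendsto (fun x : ℝ => -(k * Real.exp (-x))) Filter.atTop (nhds 0))))).const_mul k⁻¹
  simpa [Function.comp_def] using h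

lemma gumbel_law_eq (ν : Measure ℝ) [IsFiniteMeasure ν]
    (h : ∀ x, ν (Set.Iic x) = ENNReal.ofReal (Real.exp (-Real.exp (-x)))) :
    ν = volume.withDensity
      (fun x => ENNReal.ofReal (Real.exp (-x) * Real.exp (-Real.exp (-x)))) := by
  refine Measure.ext_of_Iic _ _ fun a => ?_
  rw [h, withDensity_apply _ measurableSet_Iic]
  have hi := gumbel_integrable 1 one_pos
  have hd := integral_Iic_of_hasDerivAt_of_tendsto' (a := a)
    (fun x _ => gumbel_hasDerivAt 1 one_pos x) hi.integrableOn (gumbel_tendsto_atBot 1 one_pos)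
  simp only [one_mul, inv_one, sub_zero] at hi hd
  rw [← ofReal_integral_eq_lintegral_ofReal hi.integrableOn
    (Filter.Eventually.of_forall fun x => by positivity), hd]

lemma gumbel_lintegral (ν : Measure ℝ) [IsFiniteMeasure ν]
    (h : ∀ x, ν (Set.Iic x) = ENNReal.ofReal (Real.exp (-Real.exp (-x)))) (c : ℝ) (hc : 0 ≤ c) :
    ∫⁻ x, ENNReal.ofReal (Real.exp (-(c * Real.exp (-x)))) ∂ν
      = ENNReal.ofReal (c + 1)⁻¹ := by
  have hk : 0 < c + 1 := by linarith
  rw [gumbel_law_eq ν h, lintegral_withDensity_eq_lintegral_mul _ (by fun_prop) (by fun_prop)]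
  have hd := integral_of_hasDerivAt_of_tendsto (gumbel_hasDerivAt _ hk) (gumbel_integrable _ hk)
    (gumbel_tendsto_atBot _ hk) (gumbel_tendsto_atTop _)
  rw [sub_zero] at hd
  rw [← hd, ofReal_integral_eq_lintegral_ofReal (gumbel_integrable _ hk)
    (Filter.Eventually.of_forall fun x => by positivity)]
  refine lintegral_congr fun x => ?_
  rw [Pi.mul_apply, ← ENNReal.ofReal_mul (by positivity), mul_assoc, ← Real.exp_add]
  congr 3
  ring

lemma gumbel_Iio (ν : Measure ℝ) [IsFiniteMeasure ν]
    (h : ∀ x, ν (Set.Iic x) = ENNReal.ofReal (Real.exp (-Real.exp (-x)))) (x : ℝ) :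
    ν (Set.Iio x) = ENNReal.ofReal (Real.exp (-Real.exp (-x))) := by
  have : NullSingletonClass ν := by
    rw [gumbel_law_eq ν h]; infer_instance
  rw [← h, measure_congr Iio_ae_eq_Iic]

lemma gumbel_max
    {Ω : Type*} [MeasurableSpace Ω] (μ : Measure Ω) [IsProbabilityMeasure μ]
    {S : Type*} [Fintype S]
    (r : S → ℝ) (hr0 : ∀ s, 0 ≤ r s) (hr1 : ∑ s : S, r s = 1)
    (G : S → Ω → ℝ) (hGmeas : ∀ s, Measurable (G s))
    (hGindep : iIndepFun G μ)
    (hGumbel : ∀ s x, μ {ω | G s ω ≤ x} = ENNReal.ofReal (Real.exp (-Real.exp (-x))))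
    (a : S) (ha : 0 < r a) :
    μ {ω | ∀ s : S, 0 < r s → s ≠ a →
          Real.log (r s) + G s ω < Real.log (r a) + G a ω} = ENNReal.ofReal (r a) := by
  classical
  have hlaw : ∀ s x, (μ.map (G s)) (Set.Iic x) = ENNReal.ofReal (Real.exp (-Real.exp (-x))) := by
    intro s x
    rw [Measure.map_apply (hGmeas s) measurableSet_Iic, ← hGumbel s x]; rfl
  have hprob : ∀ s, IsProbabilityMeasure (μ.map (G s)) := fun s =>
    Measure.isProbabilityMeasure_map (hGmeas s).aemeasurable
  let T : Finset S := Finset.univ.filter fun s => 0 < r s ∧ s ≠ a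
  have hdT : Disjoint ({a} : Finset S) T := by simp [T]
  let X : Ω → ℝ := G a
  let Y : Ω → (T → ℝ) := fun ω i => G i ω
  have hX : Measurable X := hGmeas a
  have hY : Measurable Y := measurable_pi_lambda _ fun i => hGmeas i
  have hXY : IndepFun X Y μ := by
    have := hGindep.indepFun_finset {a} T hdT hGmeas
    exact this.comp (φ := fun f : (({a} : Finset S) → ℝ) => f ⟨a, by simp⟩) (ψ := id)
      (measurable_pi_apply _) measurable_id
  let A : Set (ℝ × (T → ℝ)) := {z | ∀ i : T, Real.log (r i) + z.2 i < Real.log (r a) + z.1}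
  have hA : MeasurableSet A := by
    have : A = ⋂ i : T, {z | Real.log (r i) + z.2 i < Real.log (r a) + z.1} := by
      ext; simp [A]
    rw [this]
    exact MeasurableSet.iInter fun i => measurableSet_lt (by fun_prop) (by fun_prop)
  have hev : {ω | ∀ s : S, 0 < r s → s ≠ a →
      Real.log (r s) + G s ω < Real.log (r a) + G a ω} = (fun ω => (X ω, Y ω)) ⁻¹' A := by
    ext ω
    simp [A, X, Y, T]
  have hsumT : ∑ s ∈ T, r s = 1 - r a := by
    rw [← hr1, ← Finset.add_sum_erase _ _ (Finset.mem_univ a), add_sub_cancel_left]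
    refine Finset.sum_subset (fun s hs => by simp [T] at hs ⊢; exact hs.2) fun s hs hs' => ?_
    simp [T] at hs hs'
    by_contra hne
    exact hs (hs' (lt_of_le_of_ne (hr0 s) (Ne.symm hne)))
  have hra : r a ≤ 1 := by
    have : 0 ≤ ∑ s ∈ T, r s := Finset.sum_nonneg fun s _ => hr0 s
    linarith
  rw [hev, ← Measure.map_apply (hX.prodMk hY) hA, hXY.map_prod_eq_prod_map_map
    hX.aemeasurable hY.aemeasurable, Measure.prod_apply hA]
  have hsec : ∀ x : ℝ, (μ.map Y) (Prod.mk x ⁻¹' A)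
      = ENNReal.ofReal (Real.exp (-(((1 - r a) / r a) * Real.exp (-x)))) := by
    intro x
    rw [Measure.map_apply hY (measurable_prodMk_left hA)]
    have : Y ⁻¹' (Prod.mk x ⁻¹' A)
        = ⋂ s ∈ T, G s ⁻¹' (Set.Iio (Real.log (r a) + x - Real.log (r s))) := by
      ext ω
      simp [A, Y, lt_sub_iff_add_lt']
    rw [this, hGindep.measure_inter_preimage_eq_mul T fun s _ => measurableSet_Iio]
    have h1 : ∀ s ∈ T, μ (G s ⁻¹' (Set.Iio (Real.log (r a) + x - Real.log (r s))))
        = ENNReal.ofReal (Real.exp (-(r s / r a * Real.exp (-x)))) := by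
      intro s hs
      have hs0 : 0 < r s := by simp [T] at hs; exact hs.1
      have := hprob s
      rw [← Measure.map_apply (hGmeas s) measurableSet_Iio, gumbel_Iio _ (hlaw s)]
      congr 3
      rw [show -(Real.log (r a) + x - Real.log (r s)) = Real.log (r s) - Real.log (r a) + -x by
        ring, Real.exp_add, Real.exp_sub, Real.exp_log hs0, Real.exp_log ha]
    rw [Finset.prod_congr rfl h1, ← ENNReal.ofReal_prod_of_nonneg (fun _ _ => by positivity),
      ← Real.exp_sum, Finset.sum_neg_distrib, ← Finset.sum_mul, ← Finset.sum_div, hsumT]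
  simp_rw [hsec]
  have := hprob a
  rw [gumbel_lintegral _ (hlaw a) _ (div_nonneg (by linarith) ha.le)]
  congr 1
  field_simp
  ring



/-- Let `p` and `q` be probability mass functions on a finite nonempty set `S`
with disjoint supports, and let `(G s)_{s ∈ S}` be independent standard Gumbel random
variables. Fix `s₁` in the support of `p` and let `E` be the event that `s₁` is the argmax
of `log (p s) + G s` over the support of `p`. Then for every `s'` in the support of `q`,
the conditional probability, given `E`, that `s'` is the argmax of `log (q s) + G s` over
the support of `q` equals `q s'` (the counterfactual distribution equals the interventional
distribution `q`). -/
theorem gumbel_counterfactual_eq_interventional_of_disjoint_support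
    {Ω : Type*} [MeasurableSpace Ω] (μ : Measure Ω) [IsProbabilityMeasure μ]
    {S : Type*} [Fintype S] [Nonempty S]
    (p q : S → ℝ)
    (hp0 : ∀ s, 0 ≤ p s) (hp1 : ∑ s : S, p s = 1)
    (hq0 : ∀ s, 0 ≤ q s) (hq1 : ∑ s : S, q s = 1)
    (hdisj : ∀ s : S, ¬ (0 < p s ∧ 0 < q s))
    (G : S → Ω → ℝ)
    (hGmeas : ∀ s, Measurable (G s))
    (hGindep : iIndepFun (m := fun _ => Real.measurableSpace) G μ)
    (hGumbel : ∀ s x, μ {ω | G s ω ≤ x} = ENNReal.ofReal (Real.exp (-Real.exp (-x))))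
    (s₁ : S) (hs₁ : 0 < p s₁)
    (s' : S) (hs' : 0 < q s') :
    μ[{ω | ∀ s : S, 0 < q s → s ≠ s' →
          Real.log (q s) + G s ω < Real.log (q s') + G s' ω} |
        {ω | ∀ s : S, 0 < p s → s ≠ s₁ →
          Real.log (p s) + G s ω < Real.log (p s₁) + G s₁ ω}]
      = ENNReal.ofReal (q s') := by
  classical
  have hA := gumbel_max μ p hp0 hp1 G hGmeas hGindep hGumbel s₁ hs₁
  have hB := gumbel_max μ q hq0 hq1 G hGmeas hGindep hGumbel s' hs'
  let P : Finset S := Finset.univ.filter fun s => 0 < p s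
  let Q : Finset S := Finset.univ.filter fun s => 0 < q s
  have hPQ : Disjoint P Q := by
    rw [Finset.disjoint_left]
    intro s h1 h2
    simp [P, Q] at h1 h2
    exact hdisj s ⟨h1, h2⟩
  have hind := hGindep.indepFun_finset P Q hPQ hGmeas
  have key : ∀ (R : Finset S) (r : S → ℝ) (a : R), MeasurableSet {f : R → ℝ | ∀ i : R, i ≠ a →
      Real.log (r i) + f i < Real.log (r a) + f a} := by
    intro R r a
    simp only [Set.ofPred_forall]
    exact MeasurableSet.iInter fun i => MeasurableSet.iInter fun _ =>
      measurableSet_lt (by fun_prop) (by fun_prop)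
  have h1 : {ω | ∀ s : S, 0 < p s → s ≠ s₁ →
      Real.log (p s) + G s ω < Real.log (p s₁) + G s₁ ω}
      = (fun ω (i : P) => G i ω) ⁻¹' {f : P → ℝ | ∀ i : P, i ≠ ⟨s₁, by simp [P, hs₁]⟩ →
      Real.log (p i) + f i < Real.log (p s₁) + f ⟨s₁, by simp [P, hs₁]⟩} := by
    ext ω
    simp [P]
  have h2 : {ω | ∀ s : S, 0 < q s → s ≠ s' →
      Real.log (q s) + G s ω < Real.log (q s') + G s' ω}
      = (fun ω (i : Q) => G i ω) ⁻¹' {f : Q → ℝ | ∀ i : Q, i ≠ ⟨s', by simp [Q, hs']⟩ →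
      Real.log (q i) + f i < Real.log (q s') + f ⟨s', by simp [Q, hs']⟩} := by
    ext ω
    simp [Q]
  have hm1 := key P p ⟨s₁, by simp [P, hs₁]⟩
  have hm2 := key Q q ⟨s', by simp [Q, hs']⟩
  have hmul := hind.measure_inter_preimage_eq_mul _ _ hm1 hm2
  rw [← h1, ← h2, hA, hB] at hmul
  have hmeas1 : MeasurableSet {ω | ∀ s : S, 0 < p s → s ≠ s₁ →
      Real.log (p s) + G s ω < Real.log (p s₁) + G s₁ ω} := by
    rw [h1]
    exact (measurable_pi_lambda _ fun i : P => hGmeas i) hm1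
  rw [cond_apply hmeas1, hmul, hA, ← mul_assoc, ENNReal.inv_mul_cancel, one_mul]
  · simpa using hs₁
  · exact ENNReal.ofReal_ne_top
end

section
/- Let S be a finite nonempty set, let p and q be probability mass functions on S, and let (G_s)_{s∈S} be independent standard Gumbel random variables. Fix i in the support of p and let E be the event {for all s in the support of p with s ≠ i, log p(i) + G_i > log p(s) + G_s}. If j ∈ S with j ≠ i, p(j) > 0, and q(i)·p(j) ≥ q(j)·p(i) (i.e., the intervention does not increase the relative probability of j over i), then P({for all s in the support of q with s ≠ j, log q(j) + G_j > log q(s) + G_s} | E) = 0; that is, the Gumbel-max mechanism satisfies counterfactual stability: given that outcome i was observed under p, the counterfactual outcome under q is almost surely not j. -/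
open MeasureTheory ProbabilityTheory

/-- counterfactual stability of the Gumbel-max mechanism: Let `p` and `q` be
probability mass functions on a finite nonempty set `S` and `(G s)_{s ∈ S}` independent
standard Gumbel random variables. Fix `i` in the support of `p` and let `E` be the event
that `i` is the argmax of `log (p s) + G s` over the support of `p`. If `j ≠ i`,
`p j > 0`, and `q i * p j ≥ q j * p i` (the intervention does not increase the relative
probability of `j` over `i`), then conditionally on `E` the counterfactual outcome under
`q` (the argmax of `log (q s) + G s` over the support of `q`, which requires `j` to lie in
the support of `q`) is almost surely not `j`. -/
theorem gumbel_max_counterfactual_stability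
    {Ω : Type*} [MeasurableSpace Ω] (μ : Measure Ω) [IsProbabilityMeasure μ]
    {S : Type*} [Fintype S] [Nonempty S]
    (p q : S → ℝ)
    (hp0 : ∀ s, 0 ≤ p s) (hp1 : ∑ s : S, p s = 1)
    (hq0 : ∀ s, 0 ≤ q s) (hq1 : ∑ s : S, q s = 1)
    (G : S → Ω → ℝ)
    (hGmeas : ∀ s, Measurable (G s))
    (hGindep : iIndepFun G μ)
    (hGumbel : ∀ s x, μ {ω | G s ω ≤ x} = ENNReal.ofReal (Real.exp (-Real.exp (-x))))
    (i : S) (hi : 0 < p i)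
    (j : S) (hji : j ≠ i) (hj : 0 < p j)
    (hrel : q j * p i ≤ q i * p j) :
    μ[{ω | 0 < q j ∧ ∀ s : S, 0 < q s → s ≠ j →
          Real.log (q s) + G s ω < Real.log (q j) + G j ω} |
        {ω | ∀ s : S, 0 < p s → s ≠ i →
          Real.log (p s) + G s ω < Real.log (p i) + G i ω}]
      = 0 := by
  have hE : MeasurableSet {ω | ∀ s : S, 0 < p s → s ≠ i →
      Real.log (p s) + G s ω < Real.log (p i) + G i ω} := by
    simp only [Set.setOf_forall]
    refine MeasurableSet.iInter fun s => MeasurableSet.iInter fun _ => MeasurableSet.iInter fun _ => ?_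
    exact measurableSet_lt ((hGmeas s).const_add _) ((hGmeas i).const_add _)
  rw [ProbabilityTheory.cond_apply hE]
  refine mul_eq_zero_of_right _ ?_
  convert measure_empty (μ := μ)
  refine Set.eq_empty_of_forall_notMem ?_
  rintro ω ⟨h1, hqj, h2⟩
  have hqi : 0 < q i := by
    have h : 0 < q i * p j := lt_of_lt_of_le (mul_pos hqj hi) hrel
    exact pos_of_mul_pos_left h hj.le
  have a := h1 j hj hji
  have b := h2 i hqi hji.symm
  have c := Real.log_le_log (mul_pos hqj hi) hrel
  rw [Real.log_mul hqj.ne' hi.ne', Real.log_mul hqi.ne' hj.ne'] at c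
  linarith
end
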